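/- Let U, V be nonlocal vertex algebras and let R(x) be a twisting operator for (U,V). Let K be any nonlocal vertex algebra and let ψ₁: U → K, ψ₂: V → K be homomorphisms of nonlocal vertex algebras such that for all u ∈ U, v ∈ V: Y(ψ₁(u),x)ψ₂(v) ∈ K[[x]] and Y(ψ₂(v),x)ψ₁(u) = e^{xD} Y(−x)(ψ₁⊗ψ₂)R(−x)(v⊗u). Then the linear map ψ: U⊗_R V → K defined by ψ(u⊗v) = ψ₁(u)_{-1}ψ₂(v) is a homomorphism of nonlocal vertex algebras, and it is the unique such homomorphism extending both ψ₁ and ψ₂. -/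

import Mathlib

open scoped TensorProduct BigOperators

noncomputable section

/-- Integer binomial coefficient `C(n, k)` for `n : ℤ`, `k : ℕ`. -/
def zchoose (n : ℤ) (k : ℕ) : ℤ :=
  if 0 ≤ n then ((n.toNat).choose k : ℤ)
  else (-1) ^ k * ((((k : ℤ) - n - 1).toNat).choose k)

section Series

variable {V : Type*} [AddCommGroup V] [Module ℂ V]

/-- `a` is (the coefficient family of) an element of `V((x))`. -/
def IsLaurent (a : ℤ → V) : Prop := ∃ N : ℤ, ∀ n : ℤ, n < N → a n = 0

/-- `a` is an element of `V[[x]]`. -/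
def IsPowerSeries (a : ℤ → V) : Prop := ∀ n : ℤ, n < 0 → a n = 0

/-- `A` is an element of `V((x₁, x₂))` (first index: exponent of `x₁`). -/
def IsLaurent2 (A : ℤ → ℤ → V) : Prop :=
  ∃ N : ℤ, ∀ m n : ℤ, (m < N ∨ n < N) → A m n = 0

/-- `a` is an element of `V ⊗ ℂ((x)) ⊆ V((x))`: truncated below, with coefficients
lying in a finitely generated (i.e. finite dimensional) subspace. -/
def IsTensorLaurent (a : ℤ → V) : Prop :=
  IsLaurent a ∧ ∃ F : Submodule ℂ V, F.FG ∧ ∀ n, a n ∈ F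

/-- Multiply the double series `A(x₁,x₂)` by `(x₁+x₂)^k`. -/
def mulAddPow (k : ℕ) (A : ℤ → ℤ → V) : ℤ → ℤ → V := fun a b =>
  ∑ j ∈ Finset.range (k + 1), ((k.choose j : ℕ) : ℂ) • A (a - (k : ℤ) + j) (b - j)

/-- Multiply the double series `A(x₁,x₂)` by `(x₁-x₂)^k`. -/
def mulSubPow (k : ℕ) (A : ℤ → ℤ → V) : ℤ → ℤ → V := fun a b =>
  ∑ j ∈ Finset.range (k + 1),
    ((-1 : ℂ) ^ j * ((k.choose j : ℕ) : ℂ)) • A (a - (k : ℤ) + j) (b - j)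

/-- Multiply the double series `A(x₁,x₂)` by `(x₂-x₁)^k`. -/
def mulSubPow' (k : ℕ) (A : ℤ → ℤ → V) : ℤ → ℤ → V := fun a b =>
  ∑ j ∈ Finset.range (k + 1),
    ((-1 : ℂ) ^ j * ((k.choose j : ℕ) : ℂ)) • A (a - j) (b - (k : ℤ) + j)

/-- Substitute `x₁ = x₀ + x₂` in `A(x₁,x₂)`, expanding in nonnegative powers of `x₂`.
The result is indexed by (exponent of `x₀`, exponent of `x₂`). -/
def substAdd02 (A : ℤ → ℤ → V) : ℤ → ℤ → V := fun a b =>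
  ∑ᶠ i : ℕ, ((zchoose (a + i) i : ℤ) : ℂ) • A (a + i) (b - i)

/-- Substitute `x₁ = x₂ + x₀` in `A(x₁,x₂)`, expanding in nonnegative powers of `x₀`.
The result is indexed by (exponent of `x₀`, exponent of `x₂`). -/
def substAdd20 (A : ℤ → ℤ → V) : ℤ → ℤ → V := fun a b =>
  if 0 ≤ a then ∑ᶠ m : ℤ, ((zchoose m a.toNat : ℤ) : ℂ) • A m (b - m + a) else 0

/-- Multiply the double series `A(x₁,x₂)` by `f(x₂ - x₁)`, expanded in nonnegative
powers of `x₁`. -/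
def scalarMulSub (f : ℤ → ℂ) (A : ℤ → ℤ → V) : ℤ → ℤ → V := fun m n =>
  ∑ᶠ (i : ℕ) (p : ℤ),
    ((-1 : ℂ) ^ i * ((zchoose p i : ℤ) : ℂ) * f p) • A (m - i) (n - p + i)

/-- Multiply a double series by a polynomial in two variables. -/
def polyMul2 (p : MvPolynomial (Fin 2) ℂ) (A : ℤ → ℤ → V) : ℤ → ℤ → V := fun m n =>
  ∑ d ∈ p.support, MvPolynomial.coeff d p • A (m - (d 0 : ℤ)) (n - (d 1 : ℤ))

/-- The relation `A ∼ B`: `p·A = p·B` for some nonzero polynomial `p(x₁,x₂)`. -/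
def SimEq2 (A B : ℤ → ℤ → V) : Prop :=
  ∃ p : MvPolynomial (Fin 2) ℂ, p ≠ 0 ∧ ∀ m n : ℤ, polyMul2 p A m n = polyMul2 p B m n

/-- `a` is an element of the iterated Laurent series space `V((x₁))⋯((x_n))`. -/
def IsIterLaurent : (n : ℕ) → ((Fin n → ℤ) → V) → Prop
  | 0, _ => True
  | n + 1, a =>
      (∃ N : ℤ, ∀ k : Fin (n + 1) → ℤ, k (Fin.last n) < N → a k = 0) ∧
      ∀ m : ℤ, IsIterLaurent n fun k => a (Fin.snoc k m)

end Series

/-- A nonlocal vertex algebra over `ℂ`, with `Y u v n` the coefficient of `x^n`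
in `Y(u,x)v` (so `u_m v = Y u v (-m-1)`). -/
structure NLVA (V : Type*) [AddCommGroup V] [Module ℂ V] where
  Y : V →ₗ[ℂ] V →ₗ[ℂ] (ℤ → V)
  one : V
  trunc : ∀ u v : V, IsLaurent (Y u v)
  vacuum_left : ∀ (v : V) (n : ℤ), Y one v n = if n = 0 then v else 0
  creation_reg : ∀ v : V, IsPowerSeries (Y v one)
  creation_zero : ∀ v : V, Y v one 0 = v
  weak_assoc : ∀ u v w : V, ∃ k : ℕ, ∀ a b : ℤ,
    mulAddPow k (substAdd02 fun m n => Y u (Y v w n) m) a b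
      = mulAddPow k (fun a' b' => Y (Y u v a') w b') a b

namespace NLVA

variable {U V K : Type*} [AddCommGroup U] [Module ℂ U] [AddCommGroup V] [Module ℂ V]
  [AddCommGroup K] [Module ℂ K]

/-- The coefficient `Y(·)_n(·)` as a bilinear map. -/
def Yc (𝒱 : NLVA V) (n : ℤ) : V →ₗ[ℂ] V →ₗ[ℂ] V :=
  𝒱.Y.compr₂ (LinearMap.proj n)

/-- The operator `D(v) = v_{-2}𝟙`, i.e. the coefficient of `x^1` in `Y(v,x)𝟙`. -/
def D (𝒱 : NLVA V) : V →ₗ[ℂ] V :=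
  (LinearMap.proj (1 : ℤ)).comp (𝒱.Y.flip 𝒱.one)

/-- Homomorphisms of nonlocal vertex algebras. -/
def IsHom (𝒰 : NLVA U) (𝒱 : NLVA V) (f : U →ₗ[ℂ] V) : Prop :=
  f 𝒰.one = 𝒱.one ∧ ∀ (a b : U) (n : ℤ), f (𝒰.Y a b n) = 𝒱.Y (f a) (f b) n

/-- `𝒦` is generated, as a nonlocal vertex algebra, by the subset `S`. -/
def IsGeneratedBy (𝒦 : NLVA K) (S : Set K) : Prop :=
  ∀ P : Submodule ℂ K, 𝒦.one ∈ P →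
    (∀ a ∈ P, ∀ b ∈ P, ∀ n : ℤ, 𝒦.Y a b n ∈ P) → S ⊆ P → P = ⊤

/-- `𝒰` is irreducible as a module over itself. -/
def SelfIrreducible (𝒰 : NLVA U) : Prop :=
  Nontrivial U ∧
    ∀ P : Submodule ℂ U, (∀ u : U, ∀ p ∈ P, ∀ n : ℤ, 𝒰.Y u p n ∈ P) → P = ⊥ ∨ P = ⊤

/-- The coefficients of the product `Y(v₁,x₁)⋯Y(v_n,x_n)𝟙`. -/
def prodY (𝒱 : NLVA V) : (n : ℕ) → (Fin n → V) → (Fin n → ℤ) → V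
  | 0, _, _ => 𝒱.one
  | n + 1, v, k => 𝒱.Y (v 0) (prodY 𝒱 n (fun i => v i.succ) fun i => k i.succ) (k 0)

/-- Non-degeneracy in the sense of Etingof–Kazhdan: the maps
`Z_n : V^{⊗n} ⊗ ℂ((x₁))⋯((x_n)) → V((x₁))⋯((x_n))` are injective. -/
def NonDegenerate (𝒱 : NLVA V) : Prop :=
  ∀ n : ℕ, 0 < n → ∀ (r : ℕ) (v : Fin r → Fin n → V) (f : Fin r → (Fin n → ℤ) → ℂ),
    (∀ j, IsIterLaurent n (f j)) →
    LinearIndependent ℂ (fun j : Fin r => PiTensorProduct.tprod ℂ (v j)) →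
    (∀ K' : Fin n → ℤ,
      (∑ j : Fin r, ∑ᶠ L : Fin n → ℤ,
        f j L • 𝒱.prodY n (v j) fun i => K' i - L i) = 0) →
    ∀ j, f j = 0

end NLVA

/-- Countable dimension over `ℂ`. -/
def CountableDim (U : Type*) [AddCommGroup U] [Module ℂ U] : Prop :=
  ∃ s : Set U, s.Countable ∧ Submodule.span ℂ s = ⊤

/-- `𝒱` satisfies `𝒮`-locality, i.e. is a weak quantum vertex algebra. -/
def SLocal {V : Type*} [AddCommGroup V] [Module ℂ V] (𝒱 : NLVA V) : Prop :=
  ∀ u v : V, ∃ (r : ℕ) (uu vv : Fin r → V) (f : Fin r → ℤ → ℂ) (k : ℕ),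
    (∀ i, IsLaurent (f i)) ∧ ∀ (w : V) (m n : ℤ),
      mulSubPow k (fun a b => 𝒱.Y u (𝒱.Y v w b) a) m n
        = mulSubPow k (fun a b => ∑ i, scalarMulSub (f i)
            (fun a' b' => 𝒱.Y (vv i) (𝒱.Y (uu i) w a') b') a b) m n

/-- A module for a nonlocal vertex algebra. -/
structure NLVAModule {V : Type*} [AddCommGroup V] [Module ℂ V] (𝒱 : NLVA V)
    (W : Type*) [AddCommGroup W] [Module ℂ W] where
  Yw : V →ₗ[ℂ] W →ₗ[ℂ] (ℤ → W)
  trunc : ∀ (v : V) (w : W), IsLaurent (Yw v w)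
  vacuum : ∀ (w : W) (n : ℤ), Yw 𝒱.one w n = if n = 0 then w else 0
  weak_assoc : ∀ (u v : V) (w : W), ∃ k : ℕ, ∀ a b : ℤ,
    mulAddPow k (substAdd02 fun m n => Yw u (Yw v w n) m) a b
      = mulAddPow k (fun a' b' => Yw (𝒱.Y u v a') w b') a b

section Twist

variable {U V : Type*} [AddCommGroup U] [Module ℂ U] [AddCommGroup V] [Module ℂ V]

/-- Coefficient of `x₁^m x₂^n` in `(Y(x₂)⊗1)R²³(x₁)R¹²(x₁+x₂)` applied to `v ⊗ u ⊗ u'`. -/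
def hex1RHS (𝒰 : NLVA U) (Rc : ℤ → (V ⊗[ℂ] U →ₗ[ℂ] U ⊗[ℂ] V))
    (v : V) (u u' : U) (m n : ℤ) : U ⊗[ℂ] V :=
  ∑ᶠ (i : ℕ) (c : ℤ),
    ((zchoose (m - c + i) i : ℤ) : ℂ) •
      (TensorProduct.map (TensorProduct.lift (𝒰.Yc (n - i))) LinearMap.id)
        ((TensorProduct.assoc ℂ U U V).symm
          ((LinearMap.lTensor U (Rc c))
            ((TensorProduct.assoc ℂ U V U)
              ((Rc (m - c + i) (v ⊗ₜ u)) ⊗ₜ u'))))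

/-- Coefficient of `x₁^m x₂^n` in `(1⊗Y(x₂))R¹²(x₁-x₂)R²³(x₁)` applied to `v ⊗ v' ⊗ u`. -/
def hex2RHS (𝒱 : NLVA V) (Rc : ℤ → (V ⊗[ℂ] U →ₗ[ℂ] U ⊗[ℂ] V))
    (v v' : V) (u : U) (m n : ℤ) : U ⊗[ℂ] V :=
  ∑ᶠ (i : ℕ) (c : ℤ),
    ((-1 : ℂ) ^ i * ((zchoose (m - c + i) i : ℤ) : ℂ)) •
      (LinearMap.lTensor U (TensorProduct.lift (𝒱.Yc (n - i))))
        ((TensorProduct.assoc ℂ U V V)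
          ((TensorProduct.map (Rc (m - c + i)) LinearMap.id)
            ((TensorProduct.assoc ℂ V U V).symm
              (v ⊗ₜ (Rc c (v' ⊗ₜ u))))))

/-- A twisting operator `R(x) : V ⊗ U → U ⊗ V ⊗ ℂ((x))` for the ordered pair `(U,V)`,
given by its family of coefficients `Rc n`. -/
structure TwistingOp (𝒰 : NLVA U) (𝒱 : NLVA V) where
  Rc : ℤ → (V ⊗[ℂ] U →ₗ[ℂ] U ⊗[ℂ] V)
  laurent : ∀ t : V ⊗[ℂ] U, IsTensorLaurent fun n => Rc n t
  vac_right : ∀ (v : V) (n : ℤ),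
    Rc n (v ⊗ₜ 𝒰.one) = if n = 0 then 𝒰.one ⊗ₜ v else 0
  vac_left : ∀ (u : U) (n : ℤ),
    Rc n (𝒱.one ⊗ₜ u) = if n = 0 then u ⊗ₜ 𝒱.one else 0
  hex1 : ∀ (v : V) (u u' : U) (m n : ℤ),
    Rc m (v ⊗ₜ (𝒰.Y u u' n)) = hex1RHS 𝒰 Rc v u u' m n
  hex2 : ∀ (v v' : V) (u : U) (m n : ℤ),
    Rc m ((𝒱.Y v v' n) ⊗ₜ u) = hex2RHS 𝒱 Rc v v' u m n

/-- `Sc` is a two-sided inverse of `Rc` as `ℂ((x))`-linear maps (coefficientwise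
convolution), with values in the tensor with `ℂ((x))`. -/
def IsInvPair {A B : Type*} [AddCommGroup A] [Module ℂ A] [AddCommGroup B] [Module ℂ B]
    (Rc : ℤ → (A →ₗ[ℂ] B)) (Sc : ℤ → (B →ₗ[ℂ] A)) : Prop :=
  (∀ t : B, IsTensorLaurent fun n => Sc n t) ∧
  (∀ (t : A) (n : ℤ), (∑ᶠ c : ℤ, Sc c (Rc (n - c) t)) = if n = 0 then t else 0) ∧
  (∀ (t : B) (n : ℤ), (∑ᶠ c : ℤ, Rc c (Sc (n - c) t)) = if n = 0 then t else 0)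

/-- The canonical embedding `u ↦ u ⊗ 𝟙`. -/
def iotaU (𝒱 : NLVA V) : U →ₗ[ℂ] U ⊗[ℂ] V := (TensorProduct.mk ℂ U V).flip 𝒱.one

/-- The canonical embedding `v ↦ 𝟙 ⊗ v`. -/
def iotaV (𝒰 : NLVA U) : V →ₗ[ℂ] U ⊗[ℂ] V := TensorProduct.mk ℂ U V 𝒰.one

/-- The operator `D ⊗ 1 + 1 ⊗ D` on `U ⊗ V`. -/
def DUV (𝒰 : NLVA U) (𝒱 : NLVA V) : U ⊗[ℂ] V →ₗ[ℂ] U ⊗[ℂ] V :=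
  LinearMap.rTensor V 𝒰.D + LinearMap.lTensor U 𝒱.D

/-- The coefficient of `x^n` in `Y_R(u⊗v, x)(u'⊗v') = (Y(x)⊗Y(x))R²³(-x)(u⊗v⊗u'⊗v')`. -/
def YRcoef (𝒰 : NLVA U) (𝒱 : NLVA V) (Rop : TwistingOp 𝒰 𝒱)
    (u : U) (v : V) (u' : U) (v' : V) (n : ℤ) : U ⊗[ℂ] V :=
  ∑ᶠ (c : ℤ) (a : ℤ),
    ((-1 : ℂ) ^ c) •
      (TensorProduct.map (𝒰.Yc a u) ((𝒱.Yc (n - c - a)).flip v'))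
        (Rop.Rc c (v ⊗ₜ u'))

/-- `𝒯` is the twisted tensor product nonlocal vertex algebra `U ⊗_R V`. -/
def IsTwistedTensor (𝒰 : NLVA U) (𝒱 : NLVA V) (Rop : TwistingOp 𝒰 𝒱)
    (𝒯 : NLVA (U ⊗[ℂ] V)) : Prop :=
  𝒯.one = 𝒰.one ⊗ₜ 𝒱.one ∧
  ∀ (u u' : U) (v v' : V) (n : ℤ),
    𝒯.Y (u ⊗ₜ v) (u' ⊗ₜ v') n = YRcoef 𝒰 𝒱 Rop u v u' v' n

end Twist

section Aux

variable {A B W T : Type*} [AddCommGroup A] [Module ℂ A] [AddCommGroup B] [Module ℂ B]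
  [AddCommGroup W] [Module ℂ W] [AddCommGroup T] [Module ℂ T]

/-- The linear map `(a ⊗ b) ↦ Y_A(a)_e (Y_B(b)_j w)`, i.e. the coefficient
of `Y_A(x₂)(1 ⊗ Y_B(x₁)) (· ⊗ · ⊗ w)` at `x₂^e x₁^j`. -/
def sandwichMod (YA : A →ₗ[ℂ] W →ₗ[ℂ] (ℤ → W)) (YB : B →ₗ[ℂ] W →ₗ[ℂ] (ℤ → W))
    (w : W) (e j : ℤ) : A ⊗[ℂ] B →ₗ[ℂ] W :=
  TensorProduct.lift
    ((YA.compr₂ (LinearMap.proj e)).compl₂ ((YB.compr₂ (LinearMap.proj j)).flip w))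

/-- Coefficient of `x₁^m x₂^n` in `Y_A(x₂)(1 ⊗ Y_B(x₁)) q(x₂ - x₁) (⋯ ⊗ w)`, where the
series `q` is evaluated at `x₂ - x₁`, expanded in nonnegative powers of `x₁`. -/
def twistRHS (YA : A →ₗ[ℂ] W →ₗ[ℂ] (ℤ → W)) (YB : B →ₗ[ℂ] W →ₗ[ℂ] (ℤ → W))
    (q : ℤ → A ⊗[ℂ] B) (w : W) : ℤ → ℤ → W := fun m n =>
  ∑ᶠ (i : ℕ) (p : ℤ),
    ((-1 : ℂ) ^ i * ((zchoose p i : ℤ) : ℂ)) •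
      sandwichMod YA YB w (n - p + i) (m - i) (q p)

/-- As `twistRHS`, but with `q` evaluated at `-x₂ + x₁`, expanded in nonnegative
powers of `x₂`. -/
def twistRHSalt (YA : A →ₗ[ℂ] W →ₗ[ℂ] (ℤ → W)) (YB : B →ₗ[ℂ] W →ₗ[ℂ] (ℤ → W))
    (q : ℤ → A ⊗[ℂ] B) (w : W) : ℤ → ℤ → W := fun m n =>
  ∑ᶠ (i : ℕ) (p : ℤ),
    ((-1 : ℂ) ^ i * ((zchoose p i : ℤ) : ℂ)) •
      sandwichMod YA YB w (n - i) (m - p + i) (q p)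

/-- Coefficient of `x^n` in `e^{xD} F(x)` where `F` is given by its coefficients. -/
def expD (Dop : T →ₗ[ℂ] T) (F : ℤ → T) (n : ℤ) : T :=
  ∑ᶠ j : ℕ, ((j.factorial : ℂ))⁻¹ • (Dop ^ j) (F (n - j))

end Aux

section YBE

variable {V : Type*} [AddCommGroup V] [Module ℂ V]

/-- The flip of the last two tensor factors of `(V⊗V)⊗V`. -/
def swap23 : (V ⊗[ℂ] V) ⊗[ℂ] V →ₗ[ℂ] (V ⊗[ℂ] V) ⊗[ℂ] V :=
  ((TensorProduct.assoc ℂ V V V).symm.toLinearMap).comp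
    ((LinearMap.lTensor V (TensorProduct.comm ℂ V V).toLinearMap).comp
      (TensorProduct.assoc ℂ V V V).toLinearMap)

/-- `S¹²` acting on `(V⊗V)⊗V`. -/
def S12m (Sc : ℤ → (V ⊗[ℂ] V →ₗ[ℂ] V ⊗[ℂ] V)) (c : ℤ) :
    (V ⊗[ℂ] V) ⊗[ℂ] V →ₗ[ℂ] (V ⊗[ℂ] V) ⊗[ℂ] V :=
  TensorProduct.map (Sc c) LinearMap.id

/-- `S²³` acting on `(V⊗V)⊗V`. -/
def S23m (Sc : ℤ → (V ⊗[ℂ] V →ₗ[ℂ] V ⊗[ℂ] V)) (c : ℤ) :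
    (V ⊗[ℂ] V) ⊗[ℂ] V →ₗ[ℂ] (V ⊗[ℂ] V) ⊗[ℂ] V :=
  ((TensorProduct.assoc ℂ V V V).symm.toLinearMap).comp
    ((LinearMap.lTensor V (Sc c)).comp (TensorProduct.assoc ℂ V V V).toLinearMap)

/-- `S¹³` acting on `(V⊗V)⊗V`. -/
def S13m (Sc : ℤ → (V ⊗[ℂ] V →ₗ[ℂ] V ⊗[ℂ] V)) (c : ℤ) :
    (V ⊗[ℂ] V) ⊗[ℂ] V →ₗ[ℂ] (V ⊗[ℂ] V) ⊗[ℂ] V :=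
  swap23.comp ((S12m Sc c).comp swap23)

/-- `S²¹(x) = σ S(x) σ`. -/
def S21c (Sc : ℤ → (V ⊗[ℂ] V →ₗ[ℂ] V ⊗[ℂ] V)) (c : ℤ) :
    V ⊗[ℂ] V →ₗ[ℂ] V ⊗[ℂ] V :=
  ((TensorProduct.comm ℂ V V).toLinearMap).comp
    ((Sc c).comp (TensorProduct.comm ℂ V V).toLinearMap)

/-- The quantum Yang–Baxter equation
`S¹²(x)S¹³(x+z)S²³(z) = S²³(z)S¹³(x+z)S¹²(x)` (coefficient of `x^a z^b`, with
`S¹³(x+z)` expanded in nonnegative powers of `z`). -/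
def QYBE (Sc : ℤ → (V ⊗[ℂ] V →ₗ[ℂ] V ⊗[ℂ] V)) : Prop :=
  ∀ (t : (V ⊗[ℂ] V) ⊗[ℂ] V) (a b : ℤ),
    (∑ᶠ (i : ℕ) (p : ℤ), ((zchoose p i : ℤ) : ℂ) •
        S12m Sc (a - p + i) (S13m Sc p (S23m Sc (b - i) t)))
      = ∑ᶠ (i : ℕ) (p : ℤ), ((zchoose p i : ℤ) : ℂ) •
          S23m Sc (b - i) (S13m Sc p (S12m Sc (a - p + i) t))

/-- Unitarity: `S(x) S²¹(-x) = 1`. -/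
def Unitary (Sc : ℤ → (V ⊗[ℂ] V →ₗ[ℂ] V ⊗[ℂ] V)) : Prop :=
  ∀ (t : V ⊗[ℂ] V) (n : ℤ),
    (∑ᶠ c : ℤ, ((-1 : ℂ) ^ (n - c)) • Sc c (S21c Sc (n - c) t))
      = if n = 0 then t else 0

/-- `[D ⊗ 1, S(x)] = -(d/dx) S(x)`. -/
def DComm1 (𝒱 : NLVA V) (Sc : ℤ → (V ⊗[ℂ] V →ₗ[ℂ] V ⊗[ℂ] V)) : Prop :=
  ∀ (t : V ⊗[ℂ] V) (n : ℤ),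
    (LinearMap.rTensor V 𝒱.D) (Sc n t) - Sc n ((LinearMap.rTensor V 𝒱.D) t)
      = (-((n : ℂ) + 1)) • Sc (n + 1) t

/-- `Y(u,x)v = e^{xD} Y(-x) S(-x)(v⊗u)`. -/
def SkewS (𝒱 : NLVA V) (Sc : ℤ → (V ⊗[ℂ] V →ₗ[ℂ] V ⊗[ℂ] V)) : Prop :=
  ∀ (u v : V) (n : ℤ),
    𝒱.Y u v n = expD 𝒱.D (fun p => ((-1 : ℂ) ^ p) •
      ∑ᶠ c : ℤ, (TensorProduct.lift (𝒱.Yc (p - c))) (Sc c (v ⊗ₜ u))) n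

/-- `S(x₁)(Y(x₂)⊗1) = (Y(x₂)⊗1)S²³(x₁)S¹³(x₁+x₂)`. -/
def HexY1 (𝒱 : NLVA V) (Sc : ℤ → (V ⊗[ℂ] V →ₗ[ℂ] V ⊗[ℂ] V)) : Prop :=
  ∀ (t : (V ⊗[ℂ] V) ⊗[ℂ] V) (m n : ℤ),
    Sc m ((TensorProduct.map (TensorProduct.lift (𝒱.Yc n)) LinearMap.id) t)
      = ∑ᶠ (i : ℕ) (p : ℤ), ((zchoose p i : ℤ) : ℂ) •
          (TensorProduct.map (TensorProduct.lift (𝒱.Yc (n - i))) LinearMap.id)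
            (S23m Sc (m - p + i) (S13m Sc p t))

/-- `S(x₁)(1⊗Y(x₂)) = (1⊗Y(x₂))S¹²(x₁-x₂)S¹³(x₁)`. -/
def HexY2 (𝒱 : NLVA V) (Sc : ℤ → (V ⊗[ℂ] V →ₗ[ℂ] V ⊗[ℂ] V)) : Prop :=
  ∀ (t : (V ⊗[ℂ] V) ⊗[ℂ] V) (m n : ℤ),
    Sc m ((LinearMap.lTensor V (TensorProduct.lift (𝒱.Yc n)))
        ((TensorProduct.assoc ℂ V V V) t))
      = ∑ᶠ (i : ℕ) (p : ℤ), ((-1 : ℂ) ^ i * ((zchoose p i : ℤ) : ℂ)) •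
          (LinearMap.lTensor V (TensorProduct.lift (𝒱.Yc (n - i))))
            ((TensorProduct.assoc ℂ V V V)
              (S12m Sc p (S13m Sc (m - p + i) t)))

/-- A quantum vertex algebra `(V, 𝒮)`. -/
structure QVA (V : Type*) [AddCommGroup V] [Module ℂ V] where
  alg : NLVA V
  sloc : SLocal alg
  Sc : ℤ → (V ⊗[ℂ] V →ₗ[ℂ] V ⊗[ℂ] V)
  laurent : ∀ t : V ⊗[ℂ] V, IsTensorLaurent fun n => Sc n t
  qybe : QYBE Sc
  unitary : Unitary Sc
  vac : ∀ (v : V) (n : ℤ), Sc n (alg.one ⊗ₜ v) = if n = 0 then alg.one ⊗ₜ v else 0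
  dcomm : DComm1 alg Sc
  skew : SkewS alg Sc
  hex : HexY1 alg Sc

end YBE

section Bialg

variable {H : Type*} [AddCommGroup H] [Module ℂ H]

/-- A nonlocal vertex bialgebra. -/
structure NLVBialg (H : Type*) [AddCommGroup H] [Module ℂ H] where
  alg : NLVA H
  comul : H →ₗ[ℂ] H ⊗[ℂ] H
  counit : H →ₗ[ℂ] ℂ
  coassoc : ∀ h : H, (LinearMap.lTensor H comul) (comul h)
      = (TensorProduct.assoc ℂ H H H) ((LinearMap.rTensor H comul) (comul h))
  counit_comul_left : ∀ h : H,
      (TensorProduct.lid ℂ H) ((LinearMap.rTensor H counit) (comul h)) = h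
  counit_comul_right : ∀ h : H,
      (TensorProduct.rid ℂ H) ((LinearMap.lTensor H counit) (comul h)) = h
  counit_one : counit alg.one = 1
  counit_mul : ∀ (a b : H) (n : ℤ),
      counit (alg.Y a b n) = if n = 0 then counit a * counit b else 0
  comul_one : comul alg.one = alg.one ⊗ₜ alg.one
  comul_mul : ∀ (a b : H) (n : ℤ),
      comul (alg.Y a b n)
        = ∑ᶠ p : ℤ, (TensorProduct.map₂ (alg.Yc p) (alg.Yc (n - p))) (comul a) (comul b)

/-- A nonlocal vertex `H`-module-algebra. -/
structure NLVModAlg (𝓗 : NLVBialg H) (U : Type*) [AddCommGroup U] [Module ℂ U] where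
  alg : NLVA U
  act : NLVAModule 𝓗.alg U
  scalar : ∀ (h : H) (u : U), IsTensorLaurent fun n => act.Yw h u n
  vac : ∀ (h : H) (n : ℤ),
      act.Yw h alg.one n = if n = 0 then 𝓗.counit h • alg.one else 0
  compat : ∀ (h : H) (u v : U) (m n : ℤ),
      act.Yw h (alg.Y u v n) m
        = ∑ᶠ (i : ℕ) (p : ℤ), ((-1 : ℂ) ^ i * ((zchoose p i : ℤ) : ℂ)) •
            (TensorProduct.lift
              (((alg.Yc (n - i)).comp ((act.Yw.compr₂ (LinearMap.proj p)).flip u)).compl₂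
                ((act.Yw.compr₂ (LinearMap.proj (m - p + i))).flip v)))
            (𝓗.comul h)

/-- A nonlocal vertex `H`-comodule-algebra. -/
structure NLVComodAlg (𝓗 : NLVBialg H) (V : Type*) [AddCommGroup V] [Module ℂ V] where
  alg : NLVA V
  rho : V →ₗ[ℂ] H ⊗[ℂ] V
  coassoc : ∀ v : V, (LinearMap.lTensor H rho) (rho v)
      = (TensorProduct.assoc ℂ H H V) ((LinearMap.rTensor V 𝓗.comul) (rho v))
  counit_rho : ∀ v : V,
      (TensorProduct.lid ℂ V) ((LinearMap.rTensor V 𝓗.counit) (rho v)) = v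
  rho_one : rho alg.one = 𝓗.alg.one ⊗ₜ alg.one
  rho_mul : ∀ (v v' : V) (n : ℤ),
      rho (alg.Y v v' n)
        = ∑ᶠ p : ℤ, (TensorProduct.map₂ (𝓗.alg.Yc p) (alg.Yc (n - p))) (rho v) (rho v')

/-- The coefficient of `x^n` in
`Y_♯(u⊗v, x)(u'⊗v') = Y(u,x)Y(b¹(v),x)u' ⊗ Y(v²,x)v'`. -/
def Ysharp (𝓗 : NLVBialg H) {U V : Type*} [AddCommGroup U] [Module ℂ U]
    [AddCommGroup V] [Module ℂ V] (MU : NLVModAlg 𝓗 U) (CV : NLVComodAlg 𝓗 V)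
    (u : U) (v : V) (u' : U) (v' : V) (n : ℤ) : U ⊗[ℂ] V :=
  ∑ᶠ (a : ℤ) (p : ℤ),
    (TensorProduct.map
      ((MU.alg.Yc a u).comp ((MU.act.Yw.compr₂ (LinearMap.proj p)).flip u'))
      ((CV.alg.Yc (n - a - p)).flip v'))
    (CV.rho v)

/-- Rearrangement `(H⊗V)⊗U → (H⊗U)⊗V`. -/
def smashSwap {U V : Type*} [AddCommGroup U] [Module ℂ U]
    [AddCommGroup V] [Module ℂ V] :
    (H ⊗[ℂ] V) ⊗[ℂ] U →ₗ[ℂ] (H ⊗[ℂ] U) ⊗[ℂ] V :=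
  ((TensorProduct.assoc ℂ H U V).symm.toLinearMap).comp
    ((LinearMap.lTensor H (TensorProduct.comm ℂ V U).toLinearMap).comp
      (TensorProduct.assoc ℂ H V U).toLinearMap)

/-- The coefficient of `x^n` in `R(x)(v⊗u) = Y(b¹(v),-x)u ⊗ v²`. -/
def Rsmash (𝓗 : NLVBialg H) {U V : Type*} [AddCommGroup U] [Module ℂ U]
    [AddCommGroup V] [Module ℂ V] (MU : NLVModAlg 𝓗 U) (CV : NLVComodAlg 𝓗 V)
    (n : ℤ) : V ⊗[ℂ] U →ₗ[ℂ] U ⊗[ℂ] V :=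
  ((-1 : ℂ) ^ n) •
    ((TensorProduct.map
        (TensorProduct.lift (MU.act.Yw.compr₂ (LinearMap.proj n))) LinearMap.id).comp
      (smashSwap.comp (LinearMap.rTensor U CV.rho)))

end Bialg

section Combinatorics

theorem zchoose_eq (n : ℤ) (k : ℕ) : zchoose n k = Ring.choose n k := by
  unfold zchoose
  split_ifs with h
  · obtain ⟨m, rfl⟩ := Int.eq_ofNat_of_zero_le h
    simpa using (Ring.choose_natCast (R := ℤ) m k).symm
  · obtain ⟨m, hm⟩ := Int.eq_ofNat_of_zero_le (show 0 ≤ (k : ℤ) - n - 1 by omega)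
    have h1 : n = -((m : ℤ) - k + 1) := by omega
    rw [hm, h1, Ring.choose_neg, show ((m : ℤ) - k + 1 + k - 1) = m by ring,
      Ring.choose_natCast]
    simp [Int.negOnePow_def, Units.smul_def]

theorem zchoose_zero_right (n : ℤ) : zchoose n 0 = 1 := by
  rw [zchoose_eq, Ring.choose_zero_right]

theorem zchoose_succ (n : ℤ) (k : ℕ) :
    zchoose (n + 1) (k + 1) = zchoose n k + zchoose n (k + 1) := by
  simp only [zchoose_eq, Ring.choose_succ_succ]

theorem zchoose_natCast (n k : ℕ) : zchoose n k = n.choose k := by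
  rw [zchoose_eq, Ring.choose_natCast]

theorem zchoose_eq_zero {n : ℤ} {k : ℕ} (h0 : 0 ≤ n) (h : n < k) : zchoose n k = 0 := by
  obtain ⟨m, rfl⟩ := Int.eq_ofNat_of_zero_le h0
  rw [zchoose_natCast, Nat.choose_eq_zero_of_lt (by omega), Nat.cast_zero]

theorem succ_mul_zchoose (n : ℤ) (j : ℕ) :
    ((j : ℤ) + 1) * zchoose (n + 1) (j + 1) = (n + 1) * zchoose n j := by
  have := Ring.choose_smul_choose (n + 1) (n := j + 1) (k := 1) (by omega)
  simpa [zchoose_eq, Ring.choose_one_right] using this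

end Combinatorics

section DoubleSeries

variable {V : Type*} [AddCommGroup V] [Module ℂ V]

theorem mulAddPow_zero (A : ℤ → ℤ → V) (a b : ℤ) : mulAddPow 0 A a b = A a b := by
  simp [mulAddPow]

theorem mulAddPow_succ (k : ℕ) (A : ℤ → ℤ → V) (a b : ℤ) :
    mulAddPow (k + 1) A a b = mulAddPow k A (a - 1) b + mulAddPow k A a (b - 1) := by
  unfold mulAddPow
  rw [Finset.sum_range_succ' _ (k + 1)]
  simp only [Nat.choose_succ_succ, Nat.cast_add, add_smul, Finset.sum_add_distrib]
  rw [Finset.sum_range_succ (fun j => ((k.choose (j + 1) : ℕ) : ℂ) • _) k,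
    Finset.sum_range_succ' (fun j => ((k.choose j : ℕ) : ℂ) • A (a - 1 - k + j) (b - j)) k]
  simp only [Nat.choose_succ_self, Nat.cast_zero, zero_smul, add_zero, Nat.choose_zero_right,
    Nat.cast_one, one_smul, sub_zero]
  have h1 : ∀ j : ℕ, A (a - ((k : ℤ) + 1) + ((j : ℤ) + 1)) (b - ((j : ℤ) + 1))
      = A (a - k + j) (b - 1 - j) := fun j => by congr 1 <;> ring
  rw [add_assoc, add_comm]
  push_cast
  simp only [h1, sub_sub a, add_comm (1 : ℤ)]

theorem mulAddPow_swap (k : ℕ) (A : ℤ → ℤ → V) (a b : ℤ) :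
    mulAddPow k A a b = mulAddPow k (fun m n => A n m) b a := by
  induction k generalizing a b with
  | zero => simp only [mulAddPow_zero]
  | succ k ih => rw [mulAddPow_succ, mulAddPow_succ, ih, ih a, add_comm]

theorem mulAddPow_eq_of_le {k l : ℕ} (hkl : k ≤ l) {A B : ℤ → ℤ → V}
    (h : ∀ a b, mulAddPow k A a b = mulAddPow k B a b) (a b : ℤ) :
    mulAddPow l A a b = mulAddPow l B a b := by
  induction l, hkl using Nat.le_induction generalizing a b with
  | base => exact h a b
  | succ l _ ih => rw [mulAddPow_succ, mulAddPow_succ, ih, ih]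

theorem mulAddPow_sub (k : ℕ) (A B : ℤ → ℤ → V) (a b : ℤ) :
    mulAddPow k (fun m n => A m n - B m n) a b = mulAddPow k A a b - mulAddPow k B a b := by
  simp only [mulAddPow, smul_sub, Finset.sum_sub_distrib]

/-- Only the leading term survives when the coefficients of lower order in `x₁` vanish. -/
theorem mulAddPow_leading (k : ℕ) {A : ℤ → ℤ → V} {a : ℤ} (h : ∀ m < a, ∀ n, A m n = 0)
    (b : ℤ) : mulAddPow k A a b = A a (b - k) := by
  unfold mulAddPow
  rw [Finset.sum_range_succ, Finset.sum_eq_zero, zero_add]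
  · simp
  · intro j hj
    rw [h _ (by rw [Finset.mem_range] at hj; omega), smul_zero]

theorem eq_of_mulAddPow_eq (k : ℕ) {A B : ℤ → ℤ → V} (hA : ∀ m < 0, ∀ n, A m n = 0)
    (hB : ∀ m < 0, ∀ n, B m n = 0) (h : ∀ a b, mulAddPow k A a b = mulAddPow k B a b) (a b : ℤ) :
    A a b = B a b := by
  have key : ∀ N : ℕ, ∀ m < (N : ℤ), ∀ n, A m n - B m n = 0 := by
    intro N
    induction N with
    | zero => intro m hm n; rw [hA m (by simpa using hm), hB m (by simpa using hm), sub_zero]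
    | succ N ih =>
      intro m hm n
      rcases lt_or_eq_of_le (show m ≤ N by push_cast at hm; omega) with h' | rfl
      · exact ih m h' n
      · have := mulAddPow_leading k (A := fun m n => A m n - B m n) ih (n + k)
        rw [mulAddPow_sub, h, sub_self, add_sub_cancel_right] at this
        exact this.symm
  exact sub_eq_zero.1 (key (a + 1).toNat a (by omega) b)

theorem substAdd02_eq_sum {A : ℤ → ℤ → V} {N : ℤ} (hA : ∀ m, ∀ n < N, A m n = 0) {a b : ℤ}
    {S : ℕ} (hS : b - N < S) :
    substAdd02 A a b
      = ∑ i ∈ Finset.range S, ((zchoose (a + i) i : ℤ) : ℂ) • A (a + i) (b - i) := by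
  refine finsum_eq_finsetSum_of_support_subset _ fun i hi => ?_
  by_contra h
  refine hi ?_
  beta_reduce
  simp only [Finset.coe_range, Set.mem_Iio, not_lt] at h
  rw [hA _ _ (by omega), smul_zero]

theorem mulAddPow_substAdd02 (k : ℕ) {A : ℤ → ℤ → V} {N : ℤ} (hA : ∀ m, ∀ n < N, A m n = 0)
    (a b : ℤ) :
    mulAddPow k (substAdd02 A) a b = substAdd02 (fun m n => A (m - k) n) a b := by
  induction k generalizing a b with
  | zero => simp [mulAddPow_zero]
  | succ k ih =>
    rw [mulAddPow_succ, ih, ih,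
      substAdd02_eq_sum (N := N) (S := (b - N).toNat + 2) (fun m n hn => hA _ n hn) (by omega),
      substAdd02_eq_sum (N := N) (S := (b - N).toNat + 1) (fun m n hn => hA _ n hn) (by omega),
      substAdd02_eq_sum (N := N) (S := (b - N).toNat + 2) (fun m n hn => hA _ n hn) (by omega),
      Finset.sum_range_succ', Finset.sum_range_succ' _ ((b - N).toNat + 1), add_right_comm,
      ← Finset.sum_add_distrib]
    congr 1
    · refine Finset.sum_congr rfl fun i _ => ?_
      have e : a + ((i + 1 : ℕ) : ℤ) = (a - 1 + ((i + 1 : ℕ) : ℤ)) + 1 := by ring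
      rw [e, zchoose_succ, Int.cast_add, add_smul, add_comm]
      congr 1
      · congr 2 <;> push_cast <;> ring_nf
      · congr 2
        push_cast
        ring
    · simp only [zchoose_zero_right]
      congr 2
      push_cast
      ring

theorem substAdd02_eq_zero {A : ℤ → ℤ → V} (hA : ∀ m < 0, ∀ n, A m n = 0) {a : ℤ} (ha : a < 0)
    (b : ℤ) : substAdd02 A a b = 0 := by
  refine finsum_eq_zero_of_forall_eq_zero fun i => ?_
  rcases lt_or_ge (a + i) 0 with h | h
  · rw [hA _ h, smul_zero]
  · rw [zchoose_eq_zero h (by omega), Int.cast_zero, zero_smul]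

/-- If `A(x₀ + x₂, x₂)` is regular in `x₀`, then `A(x₁, x₂)` is regular in `x₁`. -/
theorem eq_zero_of_substAdd02 {A : ℤ → ℤ → V} {N : ℤ} (hA : ∀ m, ∀ n < N, A m n = 0)
    (h : ∀ a < 0, ∀ b, substAdd02 A a b = 0) {m : ℤ} (hm : m < 0) (n : ℤ) : A m n = 0 := by
  have key : ∀ t : ℕ, ∀ m < 0, ∀ n < N + t, A m n = 0 := by
    intro t
    induction t with
    | zero => intro m _ n hn; exact hA m n (by simpa using hn)
    | succ t ih =>
      intro m hm n hn
      have := h m hm n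
      rw [substAdd02_eq_sum (S := (n - N).toNat + 1) hA (by omega), Finset.sum_range_succ',
        Finset.sum_eq_zero, zero_add] at this
      · simpa [zchoose_zero_right] using this
      · intro i _
        rcases lt_or_ge (m + (i + 1 : ℕ)) 0 with h' | h'
        · rw [ih _ h' _ (by push_cast at hn ⊢; omega), smul_zero]
        · rw [zchoose_eq_zero h' (by omega), Int.cast_zero, zero_smul]
  exact key (n - N + 1).toNat m hm n (by omega)

/-- Möbius-type inversion: `f(x + 1)` evaluated at `x = -1` is `f(0)`. -/
theorem alternating_sum_taylor (d S : ℕ) (hS : d < S) (θ : ℕ → V) (hθ : ∀ m, d < m → θ m = 0) :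
    ∑ n ∈ Finset.range (d + 1), (-1 : ℂ) ^ n •
      ∑ s ∈ Finset.range S, (((n + s).choose s : ℕ) : ℂ) • θ (n + s) = θ 0 := by
  have h1 : ∀ n ∈ Finset.range (d + 1), (-1 : ℂ) ^ n •
      ∑ s ∈ Finset.range S, (((n + s).choose s : ℕ) : ℂ) • θ (n + s)
      = ∑ m ∈ Finset.range (d + 1), ((-1 : ℂ) ^ n * (m.choose n : ℕ)) • θ m := by
    intro n hn
    rw [Finset.mem_range] at hn
    have h2 : ∑ m ∈ Finset.range (n + S), ((m.choose n : ℕ) : ℂ) • θ m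
        = ∑ s ∈ Finset.range S, (((n + s).choose s : ℕ) : ℂ) • θ (n + s) := by
      rw [Finset.sum_range_add, Finset.sum_eq_zero, zero_add]
      · refine Finset.sum_congr rfl fun s _ => ?_
        rw [Nat.choose_symm_add]
      · intro m hm
        rw [Finset.mem_range] at hm
        rw [Nat.choose_eq_zero_of_lt hm, Nat.cast_zero, zero_smul]
    rw [← h2, Finset.smul_sum,
      ← Finset.sum_subset (Finset.range_subset_range.2 (show d + 1 ≤ n + S by omega))]
    · simp only [smul_smul]
    · intro m _ hm
      rw [hθ m (by simpa using hm), smul_zero, smul_zero]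
  rw [Finset.sum_congr rfl h1, Finset.sum_comm]
  simp only [← Finset.sum_smul]
  rw [Finset.sum_eq_single 0]
  · rw [Finset.sum_eq_single 0] <;> simp +contextual [Nat.choose_eq_zero_of_lt, Nat.pos_of_ne_zero]
  · intro m hm hm0
    have h3 := congrArg (Int.cast : ℤ → ℂ) (Int.alternating_sum_range_choose_of_ne hm0)
    push_cast at h3
    rw [← Finset.sum_subset (Finset.range_subset_range.2
      (show m + 1 ≤ d + 1 by rw [Finset.mem_range] at hm; omega)), h3, zero_smul]
    intro n _ hn
    rw [Nat.choose_eq_zero_of_lt (by simpa using hn), Nat.cast_zero, mul_zero]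
  · simp

end DoubleSeries

theorem substAdd02_zero_right {V : Type*} [AddCommGroup V] [Module ℂ V] {A : ℤ → ℤ → V}
    (hA : ∀ m, ∀ n < 0, A m n = 0) (a : ℤ) : substAdd02 A a 0 = A a 0 := by
  rw [substAdd02_eq_sum (S := 1) hA (by simp)]
  simp [zchoose_zero_right]

namespace NLVA

section Associativity

variable {K : Type*} [AddCommGroup K] [Module ℂ K] (𝒦 : NLVA K)

theorem exists_ge_weak_assoc (u v w : K) (l : ℕ) : ∃ k ≥ l, ∀ a b : ℤ,
    mulAddPow k (substAdd02 fun m n => 𝒦.Y u (𝒦.Y v w n) m) a b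
      = mulAddPow k (fun a' b' => 𝒦.Y (𝒦.Y u v a') w b') a b := by
  obtain ⟨k, hk⟩ := 𝒦.weak_assoc u v w
  exact ⟨max k l, le_max_right _ _, mulAddPow_eq_of_le (le_max_left _ _) hk⟩

theorem exists_Y_Y_eq_zero (u v w : K) :
    ∃ N : ℤ, ∀ m, ∀ n < N, 𝒦.Y u (𝒦.Y v w n) m = 0 := by
  obtain ⟨N, hN⟩ := 𝒦.trunc v w
  exact ⟨N, fun m n hn => by rw [hN n hn, map_zero, Pi.zero_apply]⟩

theorem Y_D (g w : K) (n : ℤ) : 𝒦.Y (𝒦.D g) w n = ((n : ℂ) + 1) • 𝒦.Y g w (n + 1) := by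
  obtain ⟨k, hk1, hk⟩ := 𝒦.exists_ge_weak_assoc g 𝒦.one w 1
  obtain ⟨k, rfl⟩ := Nat.exists_eq_add_of_le' hk1
  have hA : ∀ m, ∀ n < 0, 𝒦.Y g (𝒦.Y 𝒦.one w n) m = 0 := fun m n hn => by
    rw [𝒦.vacuum_left, if_neg hn.ne, map_zero, Pi.zero_apply]
  have hP : ∀ m < 0, ∀ n, 𝒦.Y (𝒦.Y g 𝒦.one m) w n = 0 := fun m hm n => by
    rw [𝒦.creation_reg g m hm, map_zero, LinearMap.zero_apply, Pi.zero_apply]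
  have h1 := hk 1 (n + (k + 1))
  have h0 : ∀ n < -((k : ℤ) + 1), 𝒦.Y g w n = 0 := fun n hn => by
    have := hk 0 (n + (k + 1 : ℕ))
    rw [mulAddPow_substAdd02 _ hA, mulAddPow_leading _ hP, add_sub_cancel_right,
      𝒦.creation_zero, substAdd02_eq_sum (S := 0) (fun m n hn => hA _ n hn)
        (by push_cast; omega)] at this
    simpa using this.symm
  have hL : mulAddPow (k + 1) (fun a' b' => 𝒦.Y (𝒦.Y g 𝒦.one a') w b') 1 (n + (k + 1))
      = ((k : ℂ) + 1) • 𝒦.Y g w (n + 1) + 𝒦.Y (𝒦.D g) w n := by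
    unfold mulAddPow
    beta_reduce
    rw [Finset.sum_range_succ, Finset.sum_range_succ, Finset.sum_eq_zero, zero_add]
    · congr 1
      · rw [Nat.choose_succ_self_right, show (1 : ℤ) - (k + 1 : ℕ) + k = 0 by push_cast; ring,
          𝒦.creation_zero, show n + ((k : ℤ) + 1) - k = n + 1 by ring]
        push_cast
        rfl
      · rw [Nat.choose_self, Nat.cast_one, one_smul, sub_add_cancel]
        push_cast
        rw [add_sub_cancel_right]
        rfl
    · intro j hj
      rw [Finset.mem_range] at hj
      rw [hP _ (by push_cast; omega), smul_zero]
  rw [hL, mulAddPow_substAdd02 _ hA] at h1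
  rcases lt_or_ge (n + (k + 1)) 0 with hn | hn
  · rw [substAdd02_eq_sum (S := 0) (fun m n hn => hA _ n hn) (by push_cast; omega),
      Finset.sum_range_zero] at h1
    have h2 : 𝒦.Y (𝒦.D g) w n = -(((k : ℂ) + 1) • 𝒦.Y g w (n + 1)) := by
      rw [eq_neg_iff_add_eq_zero, add_comm, ← h1]
    rw [h2, ← neg_smul]
    rcases lt_or_ge (n + 1) (-((k : ℤ) + 1)) with h | h
    · rw [h0 _ h, smul_zero, smul_zero]
    · have h3 : n = -(k + 1) - 1 := by omega
      rw [h3]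
      congr 1
      push_cast
      ring
  · obtain ⟨b, hb⟩ := Int.eq_ofNat_of_zero_le hn
    rw [substAdd02_eq_sum (S := b + 1) (fun m n hn => hA _ n hn) (by push_cast; omega),
      Finset.sum_range_succ, Finset.sum_eq_zero, zero_add, hb, 𝒦.vacuum_left, sub_self,
      if_pos rfl, show (1 : ℤ) + b - (k + 1 : ℕ) = n + 1 by push_cast; omega] at h1
    · have h3 : zchoose (1 + b) b = b + 1 := by
        rw [show (1 : ℤ) + b = (b + 1 : ℕ) by push_cast; ring, zchoose_natCast,
          Nat.choose_succ_self_right, Nat.cast_add, Nat.cast_one]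
      have h4 : (b : ℂ) = n + (k + 1) := by exact_mod_cast congrArg (Int.cast : ℤ → ℂ) hb.symm
      rw [h3, ← sub_eq_iff_eq_add', ← sub_smul] at h1
      rw [← h1]
      congr 1
      push_cast
      rw [h4]
      ring
    · intro i hi
      rw [Finset.mem_range] at hi
      rw [𝒦.vacuum_left, if_neg (by omega), map_zero, Pi.zero_apply, smul_zero]

theorem Y_D_pow (j : ℕ) (g w : K) (n : ℤ) :
    ((j.factorial : ℂ))⁻¹ • 𝒦.Y ((𝒦.D ^ j) g) w n
      = ((zchoose (n + j) j : ℤ) : ℂ) • 𝒦.Y g w (n + j) := by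
  induction j generalizing g with
  | zero => simp [zchoose_zero_right]
  | succ j ih =>
    have hj : (j : ℂ) + 1 ≠ 0 := by exact_mod_cast j.succ_ne_zero
    rw [pow_succ, Module.End.mul_apply, Nat.factorial_succ, Nat.cast_mul, mul_inv, mul_smul, ih,
      Y_D, smul_smul, smul_smul]
    have h := congrArg (Int.cast : ℤ → ℂ) (succ_mul_zchoose (n + j) j)
    push_cast at h ⊢
    rw [← add_assoc, mul_assoc, mul_comm (zchoose (n + j) j : ℂ), ← h, inv_mul_cancel_left₀ hj]

theorem Y_expD {G : ℤ → K} {N : ℤ} (hG : ∀ p < N, G p = 0) (w : K) (a b : ℤ) :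
    𝒦.Y (expD 𝒦.D G a) w b = substAdd02 (fun r p => 𝒦.Y (G p) w r) b a := by
  have h1 : expD 𝒦.D G a = ∑ j ∈ Finset.range (a - N + 1).toNat,
      ((j.factorial : ℂ))⁻¹ • (𝒦.D ^ j) (G (a - j)) := by
    refine finsum_eq_finsetSum_of_support_subset _ fun j hj => ?_
    by_contra h
    refine hj ?_
    simp only [Finset.coe_range, Set.mem_Iio, not_lt] at h
    beta_reduce
    rw [hG _ (by omega), map_zero, smul_zero]
  rw [h1, substAdd02_eq_sum (N := N) (S := (a - N + 1).toNat) _ (by omega)]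
  · simp only [map_sum, map_smul, LinearMap.sum_apply, LinearMap.smul_apply, Finset.sum_apply,
      Pi.smul_apply, Y_D_pow]
  · intro m n hn
    rw [hG n hn, map_zero, LinearMap.zero_apply, Pi.zero_apply]

/-- If `Y(u,x)v` is regular, then `Y(u,x₁)Y(v,x₂)w` is truncated in `x₁` uniformly in `x₂`, and
`Y(u₋₁v,x)w` is its restriction to the diagonal. -/
theorem Y_mode_zero {u v : K} (h : IsPowerSeries (𝒦.Y u v)) (w : K) (n : ℤ) :
    𝒦.Y (𝒦.Y u v 0) w n = ∑ᶠ m : ℤ, 𝒦.Y u (𝒦.Y v w (n - m)) m := by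
  obtain ⟨k, hk⟩ := 𝒦.weak_assoc u v w
  obtain ⟨N, hA⟩ := 𝒦.exists_Y_Y_eq_zero u v w
  have hP : ∀ m < 0, ∀ n, 𝒦.Y (𝒦.Y u v m) w n = 0 := fun m hm n => by
    rw [h m hm, map_zero, LinearMap.zero_apply, Pi.zero_apply]
  have hA' : ∀ m < 0, ∀ n, 𝒦.Y u (𝒦.Y v w n) (m - k) = 0 := fun m hm n =>
    eq_zero_of_substAdd02 (A := fun m n => 𝒦.Y u (𝒦.Y v w n) (m - k)) (N := N)
      (fun m n hn => hA _ n hn) (fun a ha b => by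
        rw [← mulAddPow_substAdd02 (A := fun m n => 𝒦.Y u (𝒦.Y v w n) m) k hA, hk,
          mulAddPow_leading _ fun m hm n => hP m (hm.trans ha) n, hP a ha]) hm n
  have h0 := hk 0 (n + k)
  have hS : n + k - N < (n + k - N + 1).toNat := by omega
  rw [mulAddPow_substAdd02 _ hA, mulAddPow_leading _ hP, add_sub_cancel_right,
    substAdd02_eq_sum (fun m n hn => hA _ n hn) hS] at h0
  rw [← h0]
  symm
  rw [finsum_eq_finsetSum_of_support_subset (s := (Finset.range (n + k - N + 1).toNat).image
    fun i : ℕ => (i : ℤ) - k), Finset.sum_image fun i _ j _ hij => by simpa using hij]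
  · refine Finset.sum_congr rfl fun i _ => ?_
    rw [zero_add, zchoose_natCast, Nat.choose_self, Nat.cast_one, Int.cast_one, one_smul]
    ring_nf
  · intro m hm
    have h1 : N ≤ n - m := by
      by_contra! h'
      exact hm (hA _ _ h')
    have h2 : 0 ≤ m + k := by
      by_contra! h'
      refine hm ?_
      simpa using hA' (m + k) h' (n - m)
    simp only [Finset.coe_image, Finset.coe_range, Set.mem_image, Set.mem_Iio]
    exact ⟨(m + k).toNat, by omega, by omega⟩

theorem Y_Y_eq_substAdd02 {u v w : K} (h : IsPowerSeries (𝒦.Y u v))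
    (hA : ∀ m < 0, ∀ n, 𝒦.Y u (𝒦.Y v w n) m = 0) (a b : ℤ) :
    𝒦.Y (𝒦.Y u v a) w b = substAdd02 (fun m n => 𝒦.Y u (𝒦.Y v w n) m) a b := by
  obtain ⟨k, hk⟩ := 𝒦.weak_assoc u v w
  refine eq_of_mulAddPow_eq k (fun m hm n => ?_) (fun m hm n => substAdd02_eq_zero hA hm n)
    (fun a b => (hk a b).symm) a b
  rw [h m hm, map_zero, LinearMap.zero_apply, Pi.zero_apply]

theorem Y_Y_mode_zero {u v w : K} (h : IsPowerSeries (𝒦.Y v w))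
    (h' : ∀ a, IsPowerSeries (𝒦.Y (𝒦.Y u v a) w)) (a : ℤ) :
    𝒦.Y u (𝒦.Y v w 0) a = 𝒦.Y (𝒦.Y u v a) w 0 := by
  obtain ⟨k, hk⟩ := 𝒦.weak_assoc u v w
  have hA : ∀ m, ∀ n < 0, 𝒦.Y u (𝒦.Y v w n) m = 0 := fun m n hn => by
    rw [h n hn, map_zero, Pi.zero_apply]
  have := hk (a + k) 0
  rw [mulAddPow_substAdd02 _ hA, substAdd02_zero_right fun m n hn => hA _ n hn, mulAddPow_swap,
    mulAddPow_leading _ fun m hm n => h' n m hm] at this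
  simpa using this

theorem Y_Y_mode_zero_of_skew {u v w : K} (h : IsPowerSeries (𝒦.Y u w)) {G : ℤ → K} {N : ℤ}
    (hG : ∀ p < N, G p = 0) (hskew : ∀ n, 𝒦.Y v u n = expD 𝒦.D G n) (l : ℕ) :
    ∃ k ≥ l, ∀ a : ℤ, 𝒦.Y v (𝒦.Y u w 0) a
      = substAdd02 (fun r p => 𝒦.Y (G p) w (r - k)) 0 (a + k) := by
  obtain ⟨k, hkl, hk⟩ := 𝒦.exists_ge_weak_assoc v u w l
  refine ⟨k, hkl, fun a => ?_⟩
  have hA : ∀ m, ∀ n < 0, 𝒦.Y v (𝒦.Y u w n) m = 0 := fun m n hn => by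
    rw [h n hn, map_zero, Pi.zero_apply]
  have := hk (a + k) 0
  simp only [hskew, 𝒦.Y_expD hG] at this
  rw [mulAddPow_substAdd02 _ hA, substAdd02_zero_right fun m n hn => hA _ n hn, mulAddPow_swap,
    mulAddPow_substAdd02 (A := fun r p => 𝒦.Y (G p) w r) (N := N), add_sub_cancel_right] at this
  · exact this
  · intro m n hn
    rw [hG n hn, map_zero, LinearMap.zero_apply, Pi.zero_apply]

end Associativity

end NLVA

section TwistedTensor

theorem exists_bound_of_fg {M M' : Type*} [AddCommGroup M] [Module ℂ M] [AddCommGroup M']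
    [Module ℂ M'] (f : ℤ → M →ₗ[ℂ] M') (hf : ∀ t, IsLaurent fun n => f n t) {F : Submodule ℂ M}
    (hF : F.FG) : ∃ N : ℤ, ∀ t ∈ F, ∀ n < N, f n t = 0 := by
  obtain ⟨s, rfl⟩ := hF
  choose N hN using hf
  obtain ⟨B, hB⟩ := (s.image N).bddBelow
  refine ⟨B, fun t ht n hn => ?_⟩
  induction ht using Submodule.span_induction with
  | mem x hx => exact hN x n (hn.trans_le (hB (by simpa using ⟨x, hx, rfl⟩)))
  | zero => exact map_zero _
  | add x y _ _ hx hy => rw [map_add, hx, hy, add_zero]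
  | smul a x _ hx => rw [map_smul, hx, smul_zero]

theorem finsum_finsum_eq_sum {M : Type*} [AddCommGroup M] {g : ℤ → ℤ → M} {s t : Finset ℤ}
    (h : ∀ c m, g c m ≠ 0 → c ∈ s ∧ m ∈ t) :
    ∑ᶠ (c : ℤ) (m : ℤ), g c m = ∑ c ∈ s, ∑ m ∈ t, g c m := by
  have h1 : ∀ c, ∑ᶠ m, g c m = ∑ m ∈ t, g c m := fun c =>
    finsum_eq_finsetSum_of_support_subset _ fun m hm => (h c m hm).2
  simp only [h1]
  refine finsum_eq_finsetSum_of_support_subset _ fun c hc => ?_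
  obtain ⟨m, -, hm⟩ := Finset.exists_ne_zero_of_sum_ne_zero hc
  exact (h c m hm).1

theorem sum_substAdd02_antidiagonal {M : Type*} [AddCommGroup M] [Module ℂ M] {A : ℤ → ℤ → M}
    {k : ℤ} (hA : ∀ m < 0, ∀ n, A m n = 0) (hA' : ∀ m, ∀ n < -k, A m n = 0) {N a c : ℤ}
    (hN : N ≤ c) (hc : c ≤ a + k) :
    ∑ p ∈ Finset.Icc N (a + k), (-1 : ℂ) ^ p • substAdd02 A (p - c) (a - p)
      = (-1 : ℂ) ^ c • A 0 (a - c) := by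
  obtain ⟨d, hd⟩ := Int.eq_ofNat_of_zero_le (sub_nonneg.2 hc)
  have h1 : ∑ p ∈ Finset.Icc N (a + k), (-1 : ℂ) ^ p • substAdd02 A (p - c) (a - p)
      = ∑ n ∈ Finset.range (d + 1), (-1 : ℂ) ^ c • (-1 : ℂ) ^ n •
        ∑ s ∈ Finset.range (d + 1), (((n + s).choose s : ℕ) : ℂ) •
          A ((n + s : ℕ) : ℤ) (a - c - (n + s : ℕ)) := by
    rw [← Finset.sum_subset (Finset.Icc_subset_Icc_left hN)]
    · symm
      refine Finset.sum_nbij' (fun n => c + n) (fun p => (p - c).toNat) ?_ ?_ ?_ ?_ ?_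
      · intro n hn
        rw [Finset.mem_range] at hn
        rw [Finset.mem_Icc]
        omega
      · intro p hp
        rw [Finset.mem_Icc] at hp
        rw [Finset.mem_range]
        omega
      · intro n _
        simp
      · intro p hp
        rw [Finset.mem_Icc] at hp
        omega
      · intro n _
        rw [substAdd02_eq_sum (S := d + 1) hA' (by push_cast; omega),
          zpow_add₀ (by norm_num), zpow_natCast, mul_smul]
        congr 2
        refine Finset.sum_congr rfl fun s _ => ?_
        rw [add_sub_cancel_left, ← Nat.cast_add, zchoose_natCast, Int.cast_natCast]
        congr 2
        push_cast
        ring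
    · intro p hp hp'
      rw [Finset.mem_Icc] at hp hp'
      rw [substAdd02_eq_zero hA (by omega), smul_zero]
  rw [h1, ← Finset.smul_sum,
    alternating_sum_taylor d (d + 1) d.lt_succ_self (fun m => A m (a - c - m))]
  · simp
  · intro m hm
    exact hA' _ _ (by omega)

theorem substAdd02_add {M : Type*} [AddCommGroup M] [Module ℂ M] {A B : ℤ → ℤ → M} {N : ℤ}
    (hA : ∀ m, ∀ n < N, A m n = 0) (hB : ∀ m, ∀ n < N, B m n = 0) (a b : ℤ) :
    substAdd02 (fun m n => A m n + B m n) a b = substAdd02 A a b + substAdd02 B a b := by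
  have hS : b - N < (b - N + 1).toNat := by omega
  rw [substAdd02_eq_sum hA hS, substAdd02_eq_sum hB hS, substAdd02_eq_sum _ hS,
    ← Finset.sum_add_distrib]
  · simp only [smul_add]
  · intro m n hn
    rw [hA m n hn, hB m n hn, add_zero]

variable {U V K : Type*} [AddCommGroup U] [Module ℂ U] [AddCommGroup V] [Module ℂ V]
  [AddCommGroup K] [Module ℂ K]

/-- The map `u ⊗ v ↦ Y(ψ₁ u)_m ψ₂ v`. -/
def modeMap (𝒦 : NLVA K) (ψ₁ : U →ₗ[ℂ] K) (ψ₂ : V →ₗ[ℂ] K) (m : ℤ) : U ⊗[ℂ] V →ₗ[ℂ] K :=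
  TensorProduct.lift (((𝒦.Yc m).comp ψ₁).compl₂ ψ₂)

/-- The map `u ⊗ v ↦ u ⊗ Y(v)_n v'`. -/
def rightMode (U : Type*) [AddCommGroup U] [Module ℂ U] (𝒱 : NLVA V) (v' : V) (n : ℤ) :
    U ⊗[ℂ] V →ₗ[ℂ] U ⊗[ℂ] V :=
  LinearMap.lTensor U ((𝒱.Yc n).flip v')

theorem modeMap_tmul (𝒦 : NLVA K) (ψ₁ : U →ₗ[ℂ] K) (ψ₂ : V →ₗ[ℂ] K) (m : ℤ) (u : U) (v : V) :
    modeMap 𝒦 ψ₁ ψ₂ m (u ⊗ₜ v) = 𝒦.Y (ψ₁ u) (ψ₂ v) m := rfl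

theorem rightMode_tmul (𝒱 : NLVA V) (v' : V) (n : ℤ) (u : U) (v : V) :
    rightMode U 𝒱 v' n (u ⊗ₜ v) = u ⊗ₜ 𝒱.Y v v' n := rfl

theorem rTensor_rightMode_eq_map (𝒱 : NLVA V) (v' : V) (n : ℤ) (f : U →ₗ[ℂ] U) (t : U ⊗[ℂ] V) :
    LinearMap.rTensor V f (rightMode U 𝒱 v' n t) = TensorProduct.map f ((𝒱.Yc n).flip v') t := by
  rw [rightMode, ← LinearMap.comp_apply, LinearMap.rTensor_comp_lTensor]

theorem rTensor_rightMode (𝒱 : NLVA V) (v' : V) (n : ℤ) (f : U →ₗ[ℂ] U) (t : U ⊗[ℂ] V) :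
    LinearMap.rTensor V f (rightMode U 𝒱 v' n t)
      = rightMode U 𝒱 v' n (LinearMap.rTensor V f t) := by
  rw [rTensor_rightMode_eq_map, rightMode, ← LinearMap.comp_apply,
    LinearMap.lTensor_comp_rTensor]

theorem lift_map_eq_modeMap (𝒦 : NLVA K) (ψ₁ : U →ₗ[ℂ] K) (ψ₂ : V →ₗ[ℂ] K) (m : ℤ)
    (t : U ⊗[ℂ] V) :
    TensorProduct.lift (𝒦.Yc m) (TensorProduct.map ψ₁ ψ₂ t) = modeMap 𝒦 ψ₁ ψ₂ m t := by
  induction t with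
  | zero => simp only [map_zero]
  | tmul u v => rfl
  | add x y hx hy => simp only [map_add, hx, hy]

theorem modeMap_eq_zero {𝒦 : NLVA K} {ψ₁ : U →ₗ[ℂ] K} {ψ₂ : V →ₗ[ℂ] K}
    (hreg : ∀ (u : U) (v : V), IsPowerSeries (𝒦.Y (ψ₁ u) (ψ₂ v))) {m : ℤ} (hm : m < 0)
    (t : U ⊗[ℂ] V) : modeMap 𝒦 ψ₁ ψ₂ m t = 0 := by
  induction t with
  | zero => exact map_zero _
  | tmul u v => exact hreg u v m hm
  | add x y hx hy => rw [map_add, hx, hy, add_zero]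

theorem isLaurent_add {M : Type*} [AddCommGroup M] {a b : ℤ → M} (ha : IsLaurent a)
    (hb : IsLaurent b) : IsLaurent fun n => a n + b n := by
  obtain ⟨N, hN⟩ := ha
  obtain ⟨N', hN'⟩ := hb
  refine ⟨min N N', fun n hn => ?_⟩
  beta_reduce
  rw [hN n (hn.trans_le (min_le_left _ _)), hN' n (hn.trans_le (min_le_right _ _)), add_zero]

theorem isLaurent_rightMode (𝒱 : NLVA V) (v' : V) (t : U ⊗[ℂ] V) :
    IsLaurent fun n => rightMode U 𝒱 v' n t := by
  induction t with
  | zero => exact ⟨0, fun n _ => map_zero _⟩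
  | tmul u v =>
    obtain ⟨N, hN⟩ := 𝒱.trunc v v'
    exact ⟨N, fun n hn => by
      beta_reduce
      rw [rightMode_tmul, hN n hn, TensorProduct.tmul_zero]⟩
  | add x y hx hy => simpa only [map_add] using isLaurent_add hx hy

theorem isLaurent_rTensor_Yc (𝒰 : NLVA U) (u : U) (t : U ⊗[ℂ] V) :
    IsLaurent fun n => LinearMap.rTensor V (𝒰.Yc n u) t := by
  induction t with
  | zero => exact ⟨0, fun n _ => map_zero _⟩
  | tmul u' v =>
    obtain ⟨N, hN⟩ := 𝒰.trunc u u'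
    refine ⟨N, fun n hn => ?_⟩
    beta_reduce
    rw [LinearMap.rTensor_tmul, show 𝒰.Yc n u u' = 0 from hN n hn, TensorProduct.zero_tmul]
  | add x y hx hy => simpa only [map_add] using isLaurent_add hx hy

section Homs

variable {𝒰 : NLVA U} {𝒱 : NLVA V} {𝒦 : NLVA K} {ψ₁ : U →ₗ[ℂ] K} {ψ₂ : V →ₗ[ℂ] K}

theorem Y_modeMap (h₂ : NLVA.IsHom 𝒱 𝒦 ψ₂)
    (hreg : ∀ (u : U) (v : V), IsPowerSeries (𝒦.Y (ψ₁ u) (ψ₂ v))) (t : U ⊗[ℂ] V) (v' : V)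
    (a b : ℤ) :
    𝒦.Y (modeMap 𝒦 ψ₁ ψ₂ a t) (ψ₂ v') b
      = substAdd02 (fun m n => modeMap 𝒦 ψ₁ ψ₂ m (rightMode U 𝒱 v' n t)) a b := by
  induction t with
  | zero => simp [substAdd02]
  | tmul u v =>
    simp only [rightMode_tmul, modeMap_tmul, h₂.2]
    refine 𝒦.Y_Y_eq_substAdd02 (hreg u v) (fun m hm n => ?_) a b
    rw [← h₂.2]
    exact hreg _ _ m hm
  | add x y hx hy =>
    obtain ⟨N, hN⟩ := isLaurent_rightMode 𝒱 v' x
    obtain ⟨N', hN'⟩ := isLaurent_rightMode 𝒱 v' y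
    beta_reduce at hN hN'
    simp only [map_add, LinearMap.add_apply, Pi.add_apply, hx, hy]
    refine (substAdd02_add (N := min N N') (fun m n hn => ?_) (fun m n hn => ?_) a b).symm
    · rw [hN n (hn.trans_le (min_le_left _ _)), map_zero]
    · rw [hN' n (hn.trans_le (min_le_right _ _)), map_zero]

theorem Y_left_modeMap_zero (h₁ : NLVA.IsHom 𝒰 𝒦 ψ₁)
    (hreg : ∀ (u : U) (v : V), IsPowerSeries (𝒦.Y (ψ₁ u) (ψ₂ v))) (u : U) (t : U ⊗[ℂ] V)
    (a : ℤ) :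
    𝒦.Y (ψ₁ u) (modeMap 𝒦 ψ₁ ψ₂ 0 t) a
      = modeMap 𝒦 ψ₁ ψ₂ 0 (LinearMap.rTensor V (𝒰.Yc a u) t) := by
  induction t with
  | zero => simp
  | tmul u' v =>
    rw [LinearMap.rTensor_tmul, modeMap_tmul, modeMap_tmul,
      𝒦.Y_Y_mode_zero (hreg u' v) (fun a => h₁.2 u u' a ▸ hreg _ v), ← h₁.2]
    rfl
  | add x y hx hy => simp only [map_add, Pi.add_apply, hx, hy]

theorem Y_right_modeMap_zero (Rop : TwistingOp 𝒰 𝒱) (h₂ : NLVA.IsHom 𝒱 𝒦 ψ₂)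
    (hreg : ∀ (u : U) (v : V), IsPowerSeries (𝒦.Y (ψ₁ u) (ψ₂ v)))
    (hskew : ∀ (v : V) (u : U) (n : ℤ),
      𝒦.Y (ψ₂ v) (ψ₁ u) n
        = expD 𝒦.D (fun p => ((-1 : ℂ) ^ p) •
            ∑ᶠ c : ℤ, (TensorProduct.lift (𝒦.Yc (p - c)))
              ((TensorProduct.map ψ₁ ψ₂) (Rop.Rc c (v ⊗ₜ u)))) n)
    (v : V) (u : U) (v' : V) (a : ℤ) :
    𝒦.Y (ψ₂ v) (modeMap 𝒦 ψ₁ ψ₂ 0 (u ⊗ₜ v')) a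
      = ∑ᶠ c : ℤ, (-1 : ℂ) ^ c •
          modeMap 𝒦 ψ₁ ψ₂ 0 (rightMode U 𝒱 v' (a - c) (Rop.Rc c (v ⊗ₜ u))) := by
  obtain ⟨⟨N, hN⟩, F, hF, hRF⟩ := Rop.laurent (v ⊗ₜ u)
  beta_reduce at hN hRF
  obtain ⟨N₂, hN₂⟩ := exists_bound_of_fg _ (isLaurent_rightMode 𝒱 v') hF
  set G : ℤ → K := fun p => ((-1 : ℂ) ^ p) •
    ∑ᶠ c : ℤ, (TensorProduct.lift (𝒦.Yc (p - c)))
      ((TensorProduct.map ψ₁ ψ₂) (Rop.Rc c (v ⊗ₜ u))) with hGdef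
  have hGsum : ∀ M : ℤ, ∀ p ≤ M, G p = (-1 : ℂ) ^ p •
      ∑ c ∈ Finset.Icc N M, modeMap 𝒦 ψ₁ ψ₂ (p - c) (Rop.Rc c (v ⊗ₜ u)) := by
    intro M p hp
    simp only [hGdef, lift_map_eq_modeMap]
    congr 1
    refine finsum_eq_finsetSum_of_support_subset _ fun c hc => ?_
    rw [Finset.coe_Icc, Set.mem_Icc]
    constructor
    · by_contra! h
      exact hc (by beta_reduce; rw [hN c h, map_zero])
    · by_contra! h
      exact hc (modeMap_eq_zero hreg (by omega) _)
  have hG : ∀ p < N, G p = 0 := fun p hp => by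
    rw [hGsum p p le_rfl, Finset.Icc_eq_empty (by omega), Finset.sum_empty, smul_zero]
  obtain ⟨k, hkl, hk⟩ := 𝒦.Y_Y_mode_zero_of_skew (hreg u v') hG (hskew v u) (-N₂).toNat
  have hR : ∀ c, ∀ n < -(k : ℤ), rightMode U 𝒱 v' n (Rop.Rc c (v ⊗ₜ u)) = 0 := fun c n hn =>
    hN₂ _ (hRF c) n (by omega)
  have hdiag : 𝒦.Y (ψ₂ v) (modeMap 𝒦 ψ₁ ψ₂ 0 (u ⊗ₜ v')) a
      = ∑ p ∈ Finset.Icc N (a + k), 𝒦.Y (G p) (ψ₂ v') (a - p) := by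
    rw [modeMap_tmul, hk, substAdd02_eq_sum (N := N) (S := (a + k - N + 1).toNat)
      (fun m n hn => by rw [hG n hn, map_zero, LinearMap.zero_apply, Pi.zero_apply]) (by omega)]
    refine Finset.sum_nbij' (fun i => a + k - i) (fun p => (a + k - p).toNat) ?_ ?_ ?_ ?_ ?_
    · intro i hi
      rw [Finset.mem_range] at hi
      rw [Finset.mem_Icc]
      omega
    · intro p hp
      rw [Finset.mem_Icc] at hp
      rw [Finset.mem_range]
      omega
    · intro i _
      simp
    · intro p hp
      rw [Finset.mem_Icc] at hp
      omega
    · intro i _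
      rw [zero_add, zchoose_natCast, Nat.choose_self, Nat.cast_one, Int.cast_one, one_smul]
      ring_nf
  have hexp : ∀ p ∈ Finset.Icc N (a + k), 𝒦.Y (G p) (ψ₂ v') (a - p)
      = ∑ c ∈ Finset.Icc N (a + k), (-1 : ℂ) ^ p • substAdd02 (fun m n =>
          modeMap 𝒦 ψ₁ ψ₂ m (rightMode U 𝒱 v' n (Rop.Rc c (v ⊗ₜ u)))) (p - c) (a - p) := by
    intro p hp
    rw [hGsum (a + k) p (Finset.mem_Icc.1 hp).2]
    simp only [map_smul, map_sum, LinearMap.smul_apply, LinearMap.sum_apply, Pi.smul_apply,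
      Finset.sum_apply, Y_modeMap h₂ hreg, Finset.smul_sum]
  rw [hdiag, Finset.sum_congr rfl hexp, Finset.sum_comm,
    finsum_eq_finsetSum_of_support_subset (s := Finset.Icc N (a + k))]
  · refine Finset.sum_congr rfl fun c hc => ?_
    rw [Finset.mem_Icc] at hc
    exact sum_substAdd02_antidiagonal (fun m hm n => modeMap_eq_zero hreg hm _)
      (fun m n hn => by rw [hR c n hn, map_zero]) hc.1 hc.2
  · intro c hc
    rw [Finset.coe_Icc, Set.mem_Icc]
    constructor
    · by_contra! h
      exact hc (by beta_reduce; rw [hN c h, map_zero, map_zero, smul_zero])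
    · by_contra! h
      exact hc (by beta_reduce; rw [hR c _ (by omega), map_zero, smul_zero])

theorem YRcoef_eq (Rop : TwistingOp 𝒰 𝒱) (u : U) (v : V) (u' : U) (v' : V) (n : ℤ) :
    YRcoef 𝒰 𝒱 Rop u v u' v' n = ∑ᶠ (c : ℤ) (m : ℤ), (-1 : ℂ) ^ c •
      LinearMap.rTensor V (𝒰.Yc m u) (rightMode U 𝒱 v' (n - c - m) (Rop.Rc c (v ⊗ₜ u'))) := by
  simp only [YRcoef, rTensor_rightMode_eq_map]

theorem modeMap_zero_YRcoef (Rop : TwistingOp 𝒰 𝒱) (h₁ : NLVA.IsHom 𝒰 𝒦 ψ₁)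
    (h₂ : NLVA.IsHom 𝒱 𝒦 ψ₂)
    (hreg : ∀ (u : U) (v : V), IsPowerSeries (𝒦.Y (ψ₁ u) (ψ₂ v)))
    (hskew : ∀ (v : V) (u : U) (n : ℤ),
      𝒦.Y (ψ₂ v) (ψ₁ u) n
        = expD 𝒦.D (fun p => ((-1 : ℂ) ^ p) •
            ∑ᶠ c : ℤ, (TensorProduct.lift (𝒦.Yc (p - c)))
              ((TensorProduct.map ψ₁ ψ₂) (Rop.Rc c (v ⊗ₜ u)))) n)
    (u : U) (v : V) (u' : U) (v' : V) (n : ℤ) :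
    modeMap 𝒦 ψ₁ ψ₂ 0 (YRcoef 𝒰 𝒱 Rop u v u' v' n)
      = 𝒦.Y (modeMap 𝒦 ψ₁ ψ₂ 0 (u ⊗ₜ v)) (modeMap 𝒦 ψ₁ ψ₂ 0 (u' ⊗ₜ v')) n := by
  obtain ⟨⟨N, hN⟩, F, hF, hRF⟩ := Rop.laurent (v ⊗ₜ u')
  beta_reduce at hN hRF
  obtain ⟨N₁, hN₁⟩ := exists_bound_of_fg _ (isLaurent_rTensor_Yc (V := V) 𝒰 u) hF
  obtain ⟨N₂, hN₂⟩ := exists_bound_of_fg _ (isLaurent_rightMode 𝒱 v') hF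
  rw [YRcoef_eq]
  set g : ℤ → ℤ → U ⊗[ℂ] V := fun c m => (-1 : ℂ) ^ c •
    LinearMap.rTensor V (𝒰.Yc m u) (rightMode U 𝒱 v' (n - c - m) (Rop.Rc c (v ⊗ₜ u'))) with hg
  have hbox : ∀ c m, g c m ≠ 0 →
      c ∈ Finset.Icc N (n - N₁ - N₂) ∧ m ∈ Finset.Icc N₁ (n - N - N₂) := by
    intro c m h
    have hc : N ≤ c := by
      by_contra! h'
      exact h (by simp only [hg, hN c h', map_zero, smul_zero])
    have hm : N₁ ≤ m := by
      by_contra! h'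
      refine h ?_
      simp only [hg, rTensor_rightMode]
      rw [hN₁ _ (hRF c) m h', map_zero, smul_zero]
    have hs : N₂ ≤ n - c - m := by
      by_contra! h'
      exact h (by simp only [hg, hN₂ _ (hRF c) _ h', map_zero, smul_zero])
    simp only [Finset.mem_Icc]
    omega
  have hinner : ∀ m : ℤ, 𝒦.Y (ψ₁ u) (𝒦.Y (ψ₂ v) (modeMap 𝒦 ψ₁ ψ₂ 0 (u' ⊗ₜ v')) (n - m)) m
      = ∑ᶠ c : ℤ, modeMap 𝒦 ψ₁ ψ₂ 0 (g c m) := by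
    intro m
    rw [Y_right_modeMap_zero Rop h₂ hreg hskew]
    change 𝒦.Yc m (ψ₁ u) _ = _
    rw [map_finsum]
    · refine finsum_congr fun c => ?_
      rw [map_smul, show n - m - c = n - c - m by ring]
      simp only [hg, map_smul]
      congr 1
      exact Y_left_modeMap_zero h₁ hreg u _ m
    · refine (Set.finite_Icc N (n - m - N₂)).subset fun c hc => ?_
      constructor
      · by_contra! h
        exact hc (by beta_reduce; rw [hN c h, map_zero, map_zero, smul_zero])
      · by_contra! h
        exact hc (by beta_reduce; rw [hN₂ _ (hRF c) _ (by omega), map_zero, smul_zero])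
  have hbox' : ∀ c m, modeMap 𝒦 ψ₁ ψ₂ 0 (g c m) ≠ 0 →
      c ∈ Finset.Icc N (n - N₁ - N₂) ∧ m ∈ Finset.Icc N₁ (n - N - N₂) := fun c m h =>
    hbox c m fun h' => h (by rw [h', map_zero])
  rw [modeMap_tmul 𝒦 ψ₁ ψ₂ 0 u v, 𝒦.Y_mode_zero (hreg u v), finsum_congr hinner,
    finsum_finsum_eq_sum hbox, finsum_finsum_eq_sum fun m c h => (hbox' c m h).symm,
    Finset.sum_comm]
  simp only [map_sum]

theorem YRcoef_one_one (Rop : TwistingOp 𝒰 𝒱) (u : U) (v : V) :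
    YRcoef 𝒰 𝒱 Rop u 𝒱.one 𝒰.one v 0 = u ⊗ₜ v := by
  have hc : ∀ c : ℤ, c ≠ 0 → ∀ m : ℤ, (-1 : ℂ) ^ c • TensorProduct.map (𝒰.Yc m u)
      ((𝒱.Yc (0 - c - m)).flip v) (Rop.Rc c (𝒱.one ⊗ₜ 𝒰.one)) = 0 := by
    intro c h m
    rw [Rop.vac_right, if_neg h, map_zero, smul_zero]
  unfold YRcoef
  rw [finsum_eq_single _ 0 fun c h => finsum_eq_zero_of_forall_eq_zero (hc c h),
    finsum_eq_single _ 0]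
  · rw [Rop.vac_right, if_pos rfl, TensorProduct.map_tmul]
    simp [NLVA.Yc, 𝒰.creation_zero, 𝒱.vacuum_left]
  · intro m hm
    rw [Rop.vac_right, if_pos rfl, TensorProduct.map_tmul]
    simp [NLVA.Yc, 𝒱.vacuum_left, hm]

end Homs

end TwistedTensor

/-- The universal property of the twisted tensor product
(Theorem 2.6). -/
theorem statement_5 {U V K : Type*} [AddCommGroup U] [Module ℂ U]
    [AddCommGroup V] [Module ℂ V] [AddCommGroup K] [Module ℂ K]
    (𝒰 : NLVA U) (𝒱 : NLVA V) (Rop : TwistingOp 𝒰 𝒱)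
    (𝒯 : NLVA (U ⊗[ℂ] V)) (h𝒯 : IsTwistedTensor 𝒰 𝒱 Rop 𝒯)
    (𝒦 : NLVA K) (ψ₁ : U →ₗ[ℂ] K) (ψ₂ : V →ₗ[ℂ] K)
    (h₁ : NLVA.IsHom 𝒰 𝒦 ψ₁) (h₂ : NLVA.IsHom 𝒱 𝒦 ψ₂)
    (hreg : ∀ (u : U) (v : V), IsPowerSeries (𝒦.Y (ψ₁ u) (ψ₂ v)))
    (hskew : ∀ (v : V) (u : U) (n : ℤ),
      𝒦.Y (ψ₂ v) (ψ₁ u) n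
        = expD 𝒦.D (fun p => ((-1 : ℂ) ^ p) •
            ∑ᶠ c : ℤ, (TensorProduct.lift (𝒦.Yc (p - c)))
              ((TensorProduct.map ψ₁ ψ₂) (Rop.Rc c (v ⊗ₜ u)))) n) :
    NLVA.IsHom 𝒯 𝒦 (TensorProduct.lift (((𝒦.Yc 0).comp ψ₁).compl₂ ψ₂)) ∧
    (∀ u : U, TensorProduct.lift (((𝒦.Yc 0).comp ψ₁).compl₂ ψ₂) (iotaU 𝒱 u) = ψ₁ u) ∧
    (∀ v : V, TensorProduct.lift (((𝒦.Yc 0).comp ψ₁).compl₂ ψ₂) (iotaV 𝒰 v) = ψ₂ v) ∧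
    ∀ φ : U ⊗[ℂ] V →ₗ[ℂ] K, NLVA.IsHom 𝒯 𝒦 φ →
      (∀ u : U, φ (iotaU 𝒱 u) = ψ₁ u) → (∀ v : V, φ (iotaV 𝒰 v) = ψ₂ v) →
      φ = TensorProduct.lift (((𝒦.Yc 0).comp ψ₁).compl₂ ψ₂) := by
  change NLVA.IsHom 𝒯 𝒦 (modeMap 𝒦 ψ₁ ψ₂ 0) ∧ (∀ u, modeMap 𝒦 ψ₁ ψ₂ 0 (u ⊗ₜ 𝒱.one) = ψ₁ u) ∧
    (∀ v, modeMap 𝒦 ψ₁ ψ₂ 0 (𝒰.one ⊗ₜ v) = ψ₂ v) ∧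
    ∀ φ : U ⊗[ℂ] V →ₗ[ℂ] K, NLVA.IsHom 𝒯 𝒦 φ → (∀ u, φ (u ⊗ₜ 𝒱.one) = ψ₁ u) →
      (∀ v, φ (𝒰.one ⊗ₜ v) = ψ₂ v) → φ = modeMap 𝒦 ψ₁ ψ₂ 0
  refine ⟨⟨?_, fun a b n => ?_⟩, fun u => ?_, fun v => ?_, fun φ hφ hU hV => ?_⟩
  · rw [h𝒯.1, modeMap_tmul, h₁.1, h₂.1, 𝒦.creation_zero]
  · induction a with
    | zero => simp only [map_zero, LinearMap.zero_apply, Pi.zero_apply]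
    | add a a' ha ha' => simp only [map_add, LinearMap.add_apply, Pi.add_apply, ha, ha']
    | tmul u v =>
      induction b with
      | zero => simp only [map_zero, Pi.zero_apply]
      | add b b' hb hb' => simp only [map_add, Pi.add_apply, hb, hb']
      | tmul u' v' => rw [h𝒯.2, modeMap_zero_YRcoef Rop h₁ h₂ hreg hskew]
  · rw [modeMap_tmul, h₂.1, 𝒦.creation_zero]
  · rw [modeMap_tmul, h₁.1, 𝒦.vacuum_left, if_pos rfl]
  · refine TensorProduct.ext' fun u v => ?_
    rw [modeMap_tmul, ← hU, ← hV, ← hφ.2, h𝒯.2, YRcoef_one_one]
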